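/- arXiv:2504.19107 — 4 statements merged into one kernel-verified Lean document; each statement's English description precedes it below -/
import Mathlib

section
/- Let A > 0, B > 0 and T > R > 1 be real constants, let p > 1, and set a = 1, b = 0, c = 1, x = −p, y = −p−1, z = 1 (these values satisfy condition (E)). If a continuous function H : [R,T) → ℝ satisfies H(t) ≥ A·t·log(t/R) for all t ∈ [R,T) and H(t) ≥ B·(log t)^{−p}·∫_R^t (∫_R^s r^{−p−1}·log(r/R)·|H(r)|^p dr) ds for all t ∈ [R,T), then T ≤ exp( max{ 2 log R_∞ , (A⁻¹ D)^{p−1} } ), where D := 2^{1 + (p+2(p−1))/(p−1)²}·p^{p/(p−1)²}·C₀^{1/(p−1)} and C₀ := (1/B)·max{1 + 2/(p−1), 1 + 2/p}. -/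
open Real MeasureTheory

/-- The limit `R_∞ = R · ∏_{k=0}^∞ (1 + 2^{-k})` of the slicing sequence. -/
noncomputable def Rinf (R : ℝ) : ℝ := R * ∏' k : ℕ, (1 + (2 : ℝ) ^ (-(k : ℝ)))

lemma step_aux
    (B T R p : ℝ) (hB : 0 < B) (hR : 1 < R) (hp : 1 < p)
    (H : ℝ → ℝ) (hHc : ContinuousOn H (Set.Ico R T))
    (hH2 : ∀ t ∈ Set.Ico R T,
      B * (Real.log t) ^ (-p) *
        ∫ s in R..t, ∫ r in R..s, r ^ (-p - 1) * Real.log (r / R) * |H r| ^ p ≤ H t)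
    (ρ lam α β K : ℝ) (hρ : R ≤ ρ) (hl : 1 < lam) (hα : 1 ≤ α) (hβ : 0 ≤ β) (hK : 0 < K)
    (h : ∀ t ∈ Set.Ico ρ T, K * t * (Real.log t) ^ (-β) * (Real.log (t / ρ)) ^ α ≤ H t) :
    ∀ t ∈ Set.Ico (ρ * lam) T, B * K ^ p / (α * p + 2) * (1 - 1 / lam) * t *
      (Real.log t) ^ (-(β * p + p)) * (Real.log (t / (ρ * lam))) ^ (α * p + 2) ≤ H t := by
  intro t ht
  have hρ0 : 0 < ρ := by linarith
  have hρ1 : 1 < ρ := by linarith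
  have hR0 : 0 < R := by linarith
  have hl0 : 0 < lam := by linarith
  have hαp : 0 < α * p := by positivity
  have hq : 0 < α * p + 2 := by linarith
  set f : ℝ → ℝ := fun r => r ^ (-p - 1) * Real.log (r / R) * |H r| ^ p with hf
  have hfc : ContinuousOn f (Set.Ico R T) := by
    have h1 : ∀ r ∈ Set.Ico R T, r ≠ 0 := fun r hr => by
      have := hr.1; intro h0; linarith
    refine ContinuousOn.mul (ContinuousOn.mul ?_ ?_) ?_
    · exact continuousOn_id.rpow_const (fun r hr => Or.inl (h1 r hr))
    · exact (continuousOn_id.div_const R).log (fun r hr => div_ne_zero (h1 r hr) hR0.ne')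
    · exact hHc.abs.rpow_const (fun r hr => Or.inr (by linarith))
  have hf0 : ∀ r, R ≤ r → 0 ≤ f r := by
    intro r hr
    have : 0 ≤ Real.log (r / R) := Real.log_nonneg ((one_le_div hR0).2 hr)
    have : 0 ≤ r := by linarith
    positivity
  have hfi : ∀ u v, R ≤ u → u ≤ v → v < T → IntervalIntegrable f volume u v := by
    intro u v hu huv hv
    apply ContinuousOn.intervalIntegrable
    rw [Set.uIcc_of_le huv]
    exact hfc.mono (fun r hr => ⟨hu.trans hr.1, hr.2.trans_lt hv⟩)
  -- inner bound
  have inner : ∀ s, ρ ≤ s → s < T →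
      K ^ p * (Real.log s) ^ (-(β * p)) * ((Real.log (s / ρ)) ^ (α * p + 2) / (α * p + 2)) ≤
        ∫ r in R..s, f r := by
    intro s hs hsT
    have e1 : ∫ r in ρ..s, f r ≤ ∫ r in R..s, f r := by
      rw [← intervalIntegral.integral_add_adjacent_intervals (hfi R ρ le_rfl hρ (by linarith))
        (hfi ρ s hρ hs hsT)]
      have := intervalIntegral.integral_nonneg (μ := volume) hρ (fun r hr => hf0 r hr.1)
      linarith
    refine le_trans ?_ e1
    have hpos : ∀ r ∈ Set.uIcc ρ s, r ≠ 0 := by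
      intro r hr
      rw [Set.uIcc_of_le hs] at hr
      have := hr.1; intro h0; linarith
    have hgc : ContinuousOn (fun r => (Real.log (r / ρ)) ^ (α * p + 1) * r⁻¹) (Set.uIcc ρ s) := by
      refine ContinuousOn.mul (ContinuousOn.rpow_const ?_ fun r hr => Or.inr (by linarith)) ?_
      · exact (continuousOn_id.div_const ρ).log (fun r hr => div_ne_zero (hpos r hr) hρ0.ne')
      · exact continuousOn_id.inv₀ hpos
    have e2 : ∫ r in ρ..s, (Real.log (r / ρ)) ^ (α * p + 1) * r⁻¹ =
        (Real.log (s / ρ)) ^ (α * p + 2) / (α * p + 2) := by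
      rw [intervalIntegral.integral_eq_sub_of_hasDerivAt
        (f := fun r => (Real.log (r / ρ)) ^ (α * p + 2) / (α * p + 2)) ?_ hgc.intervalIntegrable]
      · simp only [div_self hρ0.ne', Real.log_one]
        rw [Real.zero_rpow hq.ne']; ring
      · intro r hr
        have h0 := hpos r hr
        have d1 : HasDerivAt (fun r : ℝ => Real.log (r / ρ)) (1 / ρ / (r / ρ)) r :=
          ((hasDerivAt_id r).div_const ρ).log (div_ne_zero h0 hρ0.ne')
        have d2 := (d1.rpow_const (p := α * p + 2) (Or.inr (by linarith))).div_const (α * p + 2)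
        have d3 : 1 / ρ / (r / ρ) * (α * p + 2) * Real.log (r / ρ) ^ (α * p + 2 - 1) / (α * p + 2)
            = (Real.log (r / ρ)) ^ (α * p + 1) * r⁻¹ := by
          rw [show α * p + 2 - 1 = α * p + 1 by ring]
          field_simp
        rw [d3] at d2
        exact d2
    rw [← e2, ← intervalIntegral.integral_const_mul]
    refine intervalIntegral.integral_mono_on hs (hgc.intervalIntegrable.const_mul _)
      (hfi ρ s hρ hs hsT) ?_
    intro r hr
    have hr0 : 0 < r := by linarith [hr.1]
    have hlr : 0 < Real.log r := Real.log_pos (by linarith [hr.1])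
    have hls : Real.log r ≤ Real.log s := Real.log_le_log hr0 hr.2
    have hL : 0 ≤ Real.log (r / ρ) := Real.log_nonneg ((one_le_div hρ0).2 hr.1)
    have hHr := h r ⟨hr.1, by linarith [hr.2]⟩
    have hLR : Real.log (r / ρ) ≤ Real.log (r / R) := by
      apply Real.log_le_log (by positivity)
      gcongr
    have m1 : (K * r * (Real.log r) ^ (-β) * (Real.log (r / ρ)) ^ α) ^ p ≤ |H r| ^ p := by
      apply Real.rpow_le_rpow (by positivity) (hHr.trans (le_abs_self _)) (by linarith)
    have m2 : (K * r * (Real.log r) ^ (-β) * (Real.log (r / ρ)) ^ α) ^ p =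
        K ^ p * r ^ p * (Real.log r) ^ (-(β * p)) * (Real.log (r / ρ)) ^ (α * p) := by
      rw [Real.mul_rpow (by positivity) (by positivity), Real.mul_rpow (by positivity) (by positivity),
        Real.mul_rpow hK.le hr0.le, ← Real.rpow_mul hlr.le, ← Real.rpow_mul hL]
      ring_nf
    have m3 : (Real.log s) ^ (-(β * p)) ≤ (Real.log r) ^ (-(β * p)) :=
      Real.rpow_le_rpow_of_nonpos hlr hls (by have : 0 ≤ β * p := by positivity
                                              linarith)
    have m4 : (Real.log (r / ρ)) ^ (α * p + 1) = (Real.log (r / ρ)) ^ (α * p) * Real.log (r / ρ) :=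
      Real.rpow_add_one' hL (by linarith)
    have m5 : r ^ (-p - 1) * r ^ p = r⁻¹ := by
      rw [← Real.rpow_add hr0, ← Real.rpow_neg_one]; ring_nf
    calc K ^ p * (Real.log s) ^ (-(β * p)) * ((Real.log (r / ρ)) ^ (α * p + 1) * r⁻¹)
        ≤ K ^ p * (Real.log r) ^ (-(β * p)) * ((Real.log (r / ρ)) ^ (α * p + 1) * r⁻¹) := by
          gcongr
      _ = r ^ (-p - 1) * Real.log (r / ρ) *
          (K * r * (Real.log r) ^ (-β) * (Real.log (r / ρ)) ^ α) ^ p := by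
          rw [m2, m4, ← m5]; ring
      _ ≤ r ^ (-p - 1) * Real.log (r / R) * |H r| ^ p := by
          have : 0 ≤ Real.log (r / R) := hL.trans hLR
          gcongr
  -- outer bound
  have hρl : ρ ≤ ρ * lam := by nlinarith
  have ht0 : 0 < t := by linarith [ht.1]
  have htR : R ≤ t := by linarith [ht.1]
  have hu1 : ρ ≤ t / lam := (le_div_iff₀ hl0).2 ht.1
  have hu2 : t / lam ≤ t := div_le_self ht0.le hl.le
  have hGc : ContinuousOn (fun s => ∫ r in R..s, f r) (Set.Icc R t) := by
    have := intervalIntegral.continuousOn_primitive_interval' (f := f) (μ := volume) (a := R)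
      (hfi R t le_rfl htR ht.2) Set.left_mem_uIcc
    rwa [Set.uIcc_of_le htR] at this
  have hGi : ∀ u v, R ≤ u → u ≤ v → v ≤ t →
      IntervalIntegrable (fun s => ∫ r in R..s, f r) volume u v := by
    intro u v hu huv hv
    apply ContinuousOn.intervalIntegrable
    rw [Set.uIcc_of_le huv]
    exact hGc.mono (fun r hr => ⟨hu.trans hr.1, hr.2.trans hv⟩)
  have hlt : 0 < Real.log t := Real.log_pos (by linarith)
  have o1 : ∫ s in (t / lam)..t, (∫ r in R..s, f r) ≤ ∫ s in R..t, ∫ r in R..s, f r := by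
    rw [← intervalIntegral.integral_add_adjacent_intervals (hGi R (t / lam) le_rfl (by linarith) hu2)
        (hGi (t / lam) t (by linarith) hu2 le_rfl)]
    have := intervalIntegral.integral_nonneg (μ := volume) (f := fun s => ∫ r in R..s, f r)
      (show R ≤ t / lam by linarith)
      (fun s hs => intervalIntegral.integral_nonneg (μ := volume) hs.1 (fun r hr => hf0 r hr.1))
    linarith
  have o2 : (t - t / lam) * (K ^ p * (Real.log t) ^ (-(β * p)) *
      ((Real.log (t / (ρ * lam))) ^ (α * p + 2) / (α * p + 2))) ≤
      ∫ s in (t / lam)..t, (∫ r in R..s, f r) := by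
    rw [← smul_eq_mul, ← intervalIntegral.integral_const]
    refine intervalIntegral.integral_mono_on hu2 (by simp)
      (hGi (t / lam) t (by linarith) hu2 le_rfl) ?_
    intro s hs
    have hs1 : ρ ≤ s := hu1.trans hs.1
    refine le_trans ?_ (inner s hs1 (hs.2.trans_lt ht.2))
    have hls : 0 < Real.log s := Real.log_pos (by linarith)
    have hlst : Real.log s ≤ Real.log t := Real.log_le_log (by linarith) hs.2
    have m3 : (Real.log t) ^ (-(β * p)) ≤ (Real.log s) ^ (-(β * p)) :=
      Real.rpow_le_rpow_of_nonpos hls hlst (by have : 0 ≤ β * p := by positivity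
                                               linarith)
    have m6 : Real.log (t / (ρ * lam)) ≤ Real.log (s / ρ) := by
      apply Real.log_le_log (by positivity)
      rw [mul_comm, ← div_div]
      gcongr
      exact hs.1
    have m7 : 0 ≤ Real.log (t / (ρ * lam)) :=
      Real.log_nonneg ((one_le_div (by positivity)).2 ht.1)
    gcongr
  have fin := hH2 t ⟨htR, ht.2⟩
  refine le_trans ?_ fin
  have m8 : (Real.log t) ^ (-(β * p + p)) = (Real.log t) ^ (-(β * p)) * (Real.log t) ^ (-p) := by
    rw [← Real.rpow_add hlt]; ring_nf
  calc _ = B * (Real.log t) ^ (-p) * ((t - t / lam) * (K ^ p * (Real.log t) ^ (-(β * p)) *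
      ((Real.log (t / (ρ * lam))) ^ (α * p + 2) / (α * p + 2)))) := by
        rw [m8]; field_simp
    _ ≤ _ := by
        gcongr
        exact o2.trans o1

lemma prod_le_Rinf (R : ℝ) (hR : 1 < R) (k : ℕ) :
    R * ∏ i ∈ Finset.range k, (1 + (2 : ℝ) ^ (-(i : ℝ))) ≤ Rinf R := by
  have hs : Summable (fun i : ℕ => (2 : ℝ) ^ (-(i : ℝ))) := by
    have : (fun i : ℕ => (2 : ℝ) ^ (-(i : ℝ))) = fun i : ℕ => ((1 : ℝ) / 2) ^ i := by
      funext i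
      rw [Real.rpow_neg (by norm_num), Real.rpow_natCast]
      simp
    rw [this]
    exact summable_geometric_two
  have hm := Real.multipliable_one_add_of_summable hs
  have ht := hm.tendsto_prod_tprod_nat
  have hmono : Monotone (fun n => ∏ i ∈ Finset.range n, (1 + (2 : ℝ) ^ (-(i : ℝ)))) := by
    apply monotone_nat_of_le_succ
    intro n
    rw [Finset.prod_range_succ]
    apply le_mul_of_one_le_right
    · positivity
    · have : (0 : ℝ) < (2 : ℝ) ^ (-(n : ℝ)) := by positivity
      linarith
  have := hmono.ge_of_tendsto ht k
  unfold Rinf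
  gcongr

lemma iter_aux
    (A B T R p : ℝ)
    (hA : 0 < A) (hB : 0 < B) (hR : 1 < R) (hp : 1 < p)
    (H : ℝ → ℝ) (hHc : ContinuousOn H (Set.Ico R T))
    (hH1 : ∀ t ∈ Set.Ico R T, A * t * Real.log (t / R) ≤ H t)
    (hH2 : ∀ t ∈ Set.Ico R T,
      B * (Real.log t) ^ (-p) *
        ∫ s in R..t, ∫ r in R..s, r ^ (-p - 1) * Real.log (r / R) * |H r| ^ p ≤ H t)
    (c m E : ℝ) (hc : c = Real.log ((p + 1) / (p - 1) / B)) (hm : m = Real.log (2 * p))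
    (hE : E = Real.log A - c / (p - 1) - m * (p / (p - 1) ^ 2)) (k : ℕ) :
    R ≤ R * ∏ i ∈ Finset.range k, (1 + (2 : ℝ) ^ (-(i : ℝ))) ∧
    ∀ t ∈ Set.Ico (R * ∏ i ∈ Finset.range k, (1 + (2 : ℝ) ^ (-(i : ℝ)))) T,
      Real.exp (p ^ k * E + c / (p - 1) + m * (k / (p - 1) + p / (p - 1) ^ 2)) * t *
        (Real.log t) ^ (-(p / (p - 1) * (p ^ k - 1))) *
        (Real.log (t / (R * ∏ i ∈ Finset.range k, (1 + (2 : ℝ) ^ (-(i : ℝ)))))) ^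
          (p ^ k * ((p + 1) / (p - 1)) - 2 / (p - 1)) ≤ H t := by
  have hq : 0 < p - 1 := by linarith
  induction k with
  | zero =>
    refine ⟨by simp, ?_⟩
    intro t ht
    simp only [Finset.range_zero, Finset.prod_empty, mul_one] at ht ⊢
    have e1 : p ^ 0 * E + c / (p - 1) + m * (((0 : ℕ) : ℝ) / (p - 1) + p / (p - 1) ^ 2)
        = Real.log A := by
      rw [hE]; push_cast; ring
    have e2 : -(p / (p - 1) * (p ^ 0 - 1)) = 0 := by simp
    have e3 : p ^ 0 * ((p + 1) / (p - 1)) - 2 / (p - 1) = 1 := by field_simp; ring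
    rw [e1, e2, e3, Real.exp_log hA, Real.rpow_zero, Real.rpow_one, mul_one]
    exact hH1 t ht
  | succ k ih =>
    obtain ⟨ih1, ih2⟩ := ih
    have hpk : 1 ≤ p ^ k := one_le_pow₀ hp.le
    have h2k : (0 : ℝ) < (2 : ℝ) ^ (-(k : ℝ)) := by positivity
    rw [Finset.prod_range_succ, ← mul_assoc]
    set ρ := R * ∏ i ∈ Finset.range k, (1 + (2 : ℝ) ^ (-(i : ℝ))) with hρ
    set α := p ^ k * ((p + 1) / (p - 1)) - 2 / (p - 1) with hα
    set β := p / (p - 1) * (p ^ k - 1) with hβ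
    set u := p ^ k * E + c / (p - 1) + m * (k / (p - 1) + p / (p - 1) ^ 2) with hu
    have hα1 : 1 ≤ α := by
      have : (1 : ℝ) = 1 * ((p + 1) / (p - 1)) - 2 / (p - 1) := by field_simp; ring
      rw [hα]
      calc (1 : ℝ) = 1 * ((p + 1) / (p - 1)) - 2 / (p - 1) := this
        _ ≤ _ := by gcongr
    have hβ0 : 0 ≤ β := mul_nonneg (by positivity) (by linarith)
    have hαs : p ^ (k + 1) * ((p + 1) / (p - 1)) - 2 / (p - 1) = α * p + 2 := by
      rw [hα]; field_simp; ring
    have hβs : p / (p - 1) * (p ^ (k + 1) - 1) = β * p + p := by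
      rw [hβ]; field_simp; ring
    have hus : p ^ (k + 1) * E + c / (p - 1) + m * (((k + 1 : ℕ) : ℝ) / (p - 1) + p / (p - 1) ^ 2)
        = u * p - c - (k + 1) * m := by
      rw [hu]; push_cast; field_simp; ring
    refine ⟨?_, ?_⟩
    · nlinarith
    intro t ht
    have hst := step_aux B T R p hB hR hp H hHc hH2 ρ (1 + (2 : ℝ) ^ (-(k : ℝ))) α β (Real.exp u)
      ih1 (by linarith) hα1 hβ0 (Real.exp_pos _) ih2 t ht
    refine le_trans ?_ hst
    rw [hαs, hβs, hus]
    have ht1 : R < t := by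
      have := ht.1
      nlinarith
    have hlt : 0 < Real.log t := Real.log_pos (by linarith)
    have hρ0 : 0 < ρ := by linarith
    have hll : 0 ≤ Real.log (t / (ρ * (1 + (2 : ℝ) ^ (-(k : ℝ))))) :=
      Real.log_nonneg ((one_le_div (by positivity)).2 ht.1)
    have ht0 : 0 < t := by linarith
    gcongr
    have e1 : Real.exp u ^ p = Real.exp (u * p) := by rw [Real.exp_mul]
    have e2 : Real.exp (u * p - c - (k + 1) * m) =
        Real.exp (u * p) * (B / ((p + 1) / (p - 1))) * (1 / (2 * p) ^ (k + 1)) := by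
      rw [Real.exp_sub, Real.exp_sub, hc, Real.exp_log (by positivity), hm,
        show ((k : ℝ) + 1) * Real.log (2 * p) = ((k + 1 : ℕ) : ℝ) * Real.log (2 * p) by push_cast; ring,
        Real.exp_nat_mul, Real.exp_log (by positivity)]
      field_simp
    have e3 : (1 / 2 : ℝ) ^ (k + 1) ≤ 1 - 1 / (1 + (2 : ℝ) ^ (-(k : ℝ))) := by
      rw [Real.rpow_neg (by norm_num), Real.rpow_natCast]
      have : (1 : ℝ) ≤ 2 ^ k := one_le_pow₀ (by norm_num)
      have e : 1 - 1 / (1 + ((2 : ℝ) ^ k)⁻¹) = 1 / (2 ^ k + 1) := by field_simp; ring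
      rw [e, one_div_pow, pow_succ]
      gcongr
      linarith
    have e4 : α * p + 2 ≤ p ^ (k + 1) * ((p + 1) / (p - 1)) := by
      rw [← hαs]
      have : 0 < 2 / (p - 1) := by positivity
      linarith
    rw [e1, e2]
    calc _ = B * Real.exp (u * p) / (p ^ (k + 1) * ((p + 1) / (p - 1))) * (1 / 2) ^ (k + 1) := by
          rw [mul_pow, one_div_pow]; field_simp
      _ ≤ B * Real.exp (u * p) / (α * p + 2) * (1 - 1 / (1 + (2 : ℝ) ^ (-(k : ℝ)))) := by
          gcongr

theorem lifespan_upper_bound_special_case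
    (A B T R p : ℝ)
    (hA : 0 < A) (hB : 0 < B) (hR : 1 < R) (hT : R < T) (hp : 1 < p)
    (H : ℝ → ℝ) (hHc : ContinuousOn H (Set.Ico R T))
    (hH1 : ∀ t ∈ Set.Ico R T, A * t * Real.log (t / R) ≤ H t)
    (hH2 : ∀ t ∈ Set.Ico R T,
      B * (Real.log t) ^ (-p) *
        ∫ s in R..t, ∫ r in R..s, r ^ (-p - 1) * Real.log (r / R) * |H r| ^ p ≤ H t) :
    T ≤ Real.exp (max (2 * Real.log (Rinf R))
      ((A⁻¹ * ((2 : ℝ) ^ (1 + (p + 2 * (p - 1)) / (p - 1) ^ 2) *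
          p ^ (p / (p - 1) ^ 2) *
          ((1 / B) * max (1 + 2 / (p - 1)) (1 + 2 / p)) ^ (1 / (p - 1)))) ^ (p - 1))) := by
  by_contra hcon
  rw [not_le] at hcon
  obtain ⟨t, ht1, ht2⟩ := exists_between hcon
  have hq : 0 < p - 1 := by linarith
  have hp0 : 0 < p := by linarith
  have hC : (1 / B) * max (1 + 2 / (p - 1)) (1 + 2 / p) = (p + 1) / (p - 1) / B := by
    rw [max_eq_left]
    · field_simp; ring
    · gcongr; linarith
  rw [hC] at ht1
  have hCpos : 0 < (p + 1) / (p - 1) / B := by positivity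
  have ht0 : 0 < t := (Real.exp_pos _).trans ht1
  have hx := (Real.lt_log_iff_exp_lt ht0).2 ht1
  rw [max_lt_iff] at hx
  obtain ⟨hx1, hx2⟩ := hx
  have hRi : R ≤ Rinf R := by simpa using prod_le_Rinf R hR 0
  have hlR : 0 < Real.log (Rinf R) := Real.log_pos (by linarith)
  set x := Real.log t with hxdef
  have hx0 : 0 < x := by linarith
  have hDpos : 0 < A⁻¹ * ((2 : ℝ) ^ (1 + (p + 2 * (p - 1)) / (p - 1) ^ 2) *
          p ^ (p / (p - 1) ^ 2) * ((p + 1) / (p - 1) / B) ^ (1 / (p - 1))) := by positivity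
  have hlog := Real.log_lt_log (Real.rpow_pos_of_pos hDpos _) hx2
  rw [Real.log_rpow hDpos, Real.log_mul (by positivity) (by positivity), Real.log_inv,
    Real.log_mul (by positivity) (by positivity), Real.log_mul (by positivity) (by positivity),
    Real.log_rpow (by norm_num), Real.log_rpow hp0, Real.log_rpow hCpos] at hlog
  obtain ⟨c, hc⟩ : ∃ c, c = Real.log ((p + 1) / (p - 1) / B) := ⟨_, rfl⟩
  obtain ⟨m, hm⟩ : ∃ m, m = Real.log (2 * p) := ⟨_, rfl⟩
  obtain ⟨E, hE⟩ : ∃ E, E = Real.log A - c / (p - 1) - m * (p / (p - 1) ^ 2) := ⟨_, rfl⟩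
  have hm0 : 0 ≤ m := by rw [hm]; exact Real.log_nonneg (by linarith)
  have hm2 : m = Real.log 2 + Real.log p := by
    rw [hm, Real.log_mul (by norm_num) hp0.ne']
  rw [← hc] at hlog
  set δ := E + Real.log x / (p - 1) - (p + 1) / (p - 1) * Real.log 2 with hδ
  have hδ0 : 0 < δ := by
    have : (p - 1) * δ = Real.log x - (p - 1) * (-Real.log A +
      ((1 + (p + 2 * (p - 1)) / (p - 1) ^ 2) * Real.log 2 + p / (p - 1) ^ 2 * Real.log p +
        1 / (p - 1) * c)) := by
      rw [hδ, hE, hm2]; field_simp; ring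
    have h2 : 0 < (p - 1) * δ := by rw [this]; linarith
    exact pos_of_mul_pos_right h2 hq.le
  set Q := c / (p - 1) + (p - 2) / (p - 1) * Real.log x + 2 / (p - 1) * Real.log 2 with hQ
  have key : ∀ k : ℕ, t * (p ^ k * δ + Q + 1) ≤ H t := by
    intro k
    have hit := (iter_aux A B T R p hA hB hR hp H hHc hH1 hH2 c m E hc hm hE k)
    obtain ⟨hi1, hi2⟩ := hit
    have hle := prod_le_Rinf R hR k
    set ρ := R * ∏ i ∈ Finset.range k, (1 + (2 : ℝ) ^ (-(i : ℝ))) with hρ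
    have hρ0 : 0 < ρ := by linarith
    have hlρ : Real.log ρ ≤ Real.log (Rinf R) := Real.log_le_log hρ0 hle
    have hρt : ρ ≤ t := by
      rw [← Real.log_le_log_iff hρ0 ht0]; linarith
    have h1 := hi2 t ⟨hρt, ht2⟩
    refine le_trans ?_ h1
    have hhalf : x / 2 ≤ Real.log (t / ρ) := by
      rw [Real.log_div ht0.ne' hρ0.ne']; linarith
    have hpk : 1 ≤ p ^ k := one_le_pow₀ hp.le
    have hα0 : 0 ≤ p ^ k * ((p + 1) / (p - 1)) - 2 / (p - 1) := by
      have : (1 : ℝ) = 1 * ((p + 1) / (p - 1)) - 2 / (p - 1) := by field_simp; ring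
      calc (0 : ℝ) ≤ 1 * ((p + 1) / (p - 1)) - 2 / (p - 1) := by rw [← this]; norm_num
        _ ≤ _ := by gcongr
    set α := p ^ k * ((p + 1) / (p - 1)) - 2 / (p - 1) with hα
    set β := p / (p - 1) * (p ^ k - 1) with hβ
    calc t * (p ^ k * δ + Q + 1)
        ≤ t * Real.exp (p ^ k * E + c / (p - 1) + m * (k / (p - 1) + p / (p - 1) ^ 2) +
            Real.log x * (-β) + Real.log (x / 2) * α) := by
          gcongr
          refine le_trans ?_ (Real.add_one_le_exp _)
          have hn : 0 ≤ m * (k / (p - 1) + p / (p - 1) ^ 2) := by positivity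
          have : p ^ k * E + c / (p - 1) + Real.log x * (-β) + Real.log (x / 2) * α
              = p ^ k * δ + Q := by
            rw [Real.log_div hx0.ne' (by norm_num), hδ, hQ, hα, hβ]; field_simp; ring
          linarith
      _ = Real.exp (p ^ k * E + c / (p - 1) + m * (k / (p - 1) + p / (p - 1) ^ 2)) * t *
            x ^ (-β) * (x / 2) ^ α := by
          rw [Real.exp_add, Real.exp_add _ (Real.log x * (-β)), Real.rpow_def_of_pos hx0,
            Real.rpow_def_of_pos (by positivity : 0 < x / 2)]
          ring
      _ ≤ _ := by gcongr
  obtain ⟨k, hk⟩ := pow_unbounded_of_one_lt ((H t / t - Q - 1) / δ) hp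
  have h3 := key k
  rw [div_lt_iff₀ hδ0] at hk
  have h4 : H t / t < p ^ k * δ + Q + 1 := by linarith
  rw [div_lt_iff₀ ht0] at h4
  linarith
end

section
/- (Single iteration step of the slicing method.) Let B > 0, T > R > 1, and let exponents a,x,y,z,p satisfy p > 1, a ≤ 1, y + p·a = −1 and z ≥ 0. Let A' > 0, b' ≥ 0, c' ∈ ℝ with p·c' + z + 1 > 0, and let R' ∈ [R, T). Suppose a continuous function H : [R,T) → ℝ satisfies H(t) ≥ B·(log t)^x·∫_R^t (∫_R^s r^y·(log(r/R))^z·|H(r)|^p dr) ds for all t ∈ [R,T), and H(t) ≥ A'·t^a·(log t)^{−b'}·(log(t/R'))^{c'} for all t ∈ [R',T). Then for every δ > 0 and all t ∈ [(1+δ)R', T): H(t) ≥ (δ·A'^p·B / ((1+δ)(p·c' + z + 1))) · t^a · (log t)^{−(p·b' − x)} · (log(t/((1+δ)R')))^{p·c'+z+1}. -/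
open Real MeasureTheory

theorem slicing_iteration_step
    (B T R a x y z p : ℝ)
    (hB : 0 < B) (hR : 1 < R) (hT : R < T)
    (hp : 1 < p) (ha : a ≤ 1) (hy : y + p * a = -1) (hz0 : 0 ≤ z)
    (A' b' c' R' : ℝ)
    (hA' : 0 < A') (hb' : 0 ≤ b') (hc' : 0 < p * c' + z + 1)
    (hR' : R' ∈ Set.Ico R T)
    (H : ℝ → ℝ) (hHc : ContinuousOn H (Set.Ico R T))
    (hH2 : ∀ t ∈ Set.Ico R T,
      B * (Real.log t) ^ x *
        ∫ s in R..t, ∫ r in R..s, r ^ y * (Real.log (r / R)) ^ z * |H r| ^ p ≤ H t)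
    (hH1 : ∀ t ∈ Set.Ico R' T,
      A' * t ^ a * (Real.log t) ^ (-b') * (Real.log (t / R')) ^ c' ≤ H t) :
    ∀ δ > (0 : ℝ), ∀ t ∈ Set.Ico ((1 + δ) * R') T,
      δ * A' ^ p * B / ((1 + δ) * (p * c' + z + 1)) * t ^ a *
        (Real.log t) ^ (-(p * b' - x)) *
        (Real.log (t / ((1 + δ) * R'))) ^ (p * c' + z + 1) ≤ H t := by
  obtain ⟨hRR', hR'T⟩ := hR'
  intro δ hδ t ht
  obtain ⟨ht1, htT⟩ := ht
  have hR0 : 0 < R := by linarith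
  have hR'0 : 0 < R' := by linarith
  have hd1 : 0 < 1 + δ := by linarith
  have hR't : R' ≤ t := by nlinarith
  have ht0 : 0 < t := by linarith
  have ht1' : 1 < t := by linarith
  have hlt : 0 < Real.log t := Real.log_pos ht1'
  set κ := p * c' + z + 1 with hκ
  set f : ℝ → ℝ := fun r => r ^ y * (Real.log (r / R)) ^ z * |H r| ^ p with hf
  have hfc : ContinuousOn f (Set.Icc R t) := by
    have hsub : Set.Icc R t ⊆ Set.Ico R T := fun r hr => ⟨hr.1, hr.2.trans_lt htT⟩
    refine ContinuousOn.mul (ContinuousOn.mul ?_ ?_) ?_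
    · intro r hr
      exact (Real.continuousAt_rpow_const r y (Or.inl (by linarith [hr.1]))).continuousWithinAt
    · refine ContinuousOn.rpow_const ?_ (fun _ _ => Or.inr hz0)
      refine ContinuousOn.log (continuousOn_id.div_const R) ?_
      intro r hr
      have : 0 < r := by linarith [hr.1]
      positivity
    · exact ((hHc.mono hsub).abs).rpow_const (fun _ _ => Or.inr (by linarith))
  have hfnn : ∀ r, R ≤ r → 0 ≤ f r := by
    intro r hr
    have h1 : 0 ≤ Real.log (r / R) := Real.log_nonneg ((one_le_div hR0).2 hr)
    have : 0 < r := by linarith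
    simp only [hf]
    positivity
  have hfi : ∀ u v, R ≤ u → u ≤ v → v ≤ t → IntervalIntegrable f volume u v := by
    intro u v hu huv hv
    apply ContinuousOn.intervalIntegrable_of_Icc huv
    exact hfc.mono (Set.Icc_subset_Icc hu hv)
  set F : ℝ → ℝ := fun s => ∫ r in R..s, f r with hF
  have hRt : R ≤ t := by linarith
  have hFc : ContinuousOn F (Set.Icc R t) := by
    have := intervalIntegral.continuousOn_primitive_interval (f := f) (μ := volume) (a := R) (b := t)
      (by rw [Set.uIcc_of_le hRt]; exact hfc.integrableOn_Icc)
    rwa [Set.uIcc_of_le hRt] at this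
  have hFnn : ∀ s, R ≤ s → 0 ≤ F s := by
    intro s hs
    exact intervalIntegral.integral_nonneg hs (fun r hr => hfnn r hr.1)
  set C := A' ^ p * (Real.log t) ^ (-(p * b')) with hC
  have hC0 : 0 < C := by positivity
  have hκ0 : κ ≠ 0 := hc'.ne'
  have key : ∀ s, R' ≤ s → s ≤ t → C * (Real.log (s / R')) ^ κ / κ ≤ F s := by
    intro s hs hst
    have h1 : F s = (∫ r in R..R', f r) + ∫ r in R'..s, f r :=
      (intervalIntegral.integral_add_adjacent_intervals (hfi _ _ le_rfl hRR' hR't)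
        (hfi _ _ hRR' hs hst)).symm
    have h2 : 0 ≤ ∫ r in R..R', f r := hFnn R' hRR'
    have h3 := intervalIntegral.sub_le_integral_of_hasDeriv_right_of_le
      (g := fun r => C * (Real.log (r / R')) ^ κ / κ)
      (g' := fun r => C * (Real.log (r / R')) ^ (κ - 1) * r⁻¹) (φ := f) hs ?_ ?_ ?_ ?_
    · simp only [div_self hR'0.ne', Real.log_one, Real.zero_rpow hκ0, mul_zero, zero_div, sub_zero] at h3
      linarith
    · refine ContinuousOn.div_const (ContinuousOn.mul continuousOn_const ?_) _
      refine ContinuousOn.rpow_const ?_ (fun _ _ => Or.inr hc'.le)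
      refine ContinuousOn.log (continuousOn_id.div_const R') ?_
      intro r hr
      have : 0 < r := by linarith [hr.1]
      positivity
    · intro r hr
      have hr0 : 0 < r := by linarith [hr.1]
      have hl : 0 < Real.log (r / R') := Real.log_pos ((one_lt_div hR'0).2 hr.1)
      have hd : HasDerivAt (fun r => Real.log (r / R')) (r⁻¹) r := by
        have := ((hasDerivAt_id' r).div_const R').log (by positivity)
        convert this using 1
        field_simp
      have := ((hd.rpow_const (p := κ) (Or.inl hl.ne')).const_mul C).div_const κ
      refine (HasDerivAt.congr_deriv this ?_).hasDerivWithinAt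
      field_simp
    · exact (hfc.mono (Set.Icc_subset_Icc hRR' hst)).integrableOn_Icc
    · intro r hr
      have hr0 : 0 < r := by linarith [hr.1]
      have hr1 : 1 < r := by linarith [hr.1]
      have hlr : 0 < Real.log r := Real.log_pos hr1
      have hl : 0 < Real.log (r / R') := Real.log_pos ((one_lt_div hR'0).2 hr.1)
      have hH := hH1 r ⟨hr.1.le, by linarith [hr.2]⟩
      have e1 : (A' * r ^ a * (Real.log r) ^ (-b') * (Real.log (r / R')) ^ c') ^ p ≤ |H r| ^ p :=
        Real.rpow_le_rpow (by positivity) (hH.trans (le_abs_self _)) (by linarith)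
      rw [Real.mul_rpow (by positivity) (by positivity), Real.mul_rpow (by positivity) (by positivity),
        Real.mul_rpow (by positivity) (by positivity), ← Real.rpow_mul hr0.le,
        ← Real.rpow_mul hlr.le, ← Real.rpow_mul hl.le] at e1
      have e2 : (Real.log (r / R')) ^ z ≤ (Real.log (r / R)) ^ z := by
        apply Real.rpow_le_rpow hl.le _ hz0
        apply Real.log_le_log (by positivity)
        gcongr
      have e3 : (Real.log t) ^ (-(p * b')) ≤ (Real.log r) ^ (-b' * p) := by
        rw [show -b' * p = -(p * b') by ring]
        apply Real.rpow_le_rpow_of_nonpos hlr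
        · exact Real.log_le_log hr0 (by linarith [hr.2])
        · have : 0 ≤ p * b' := by positivity
          linarith
      have e4 : r⁻¹ = r ^ y * r ^ (a * p) := by
        rw [← Real.rpow_add hr0, show y + a * p = -1 by linarith, Real.rpow_neg_one]
      have e5 : (Real.log (r / R')) ^ (κ - 1)
          = (Real.log (r / R')) ^ z * (Real.log (r / R')) ^ (c' * p) := by
        rw [← Real.rpow_add hl]
        congr 1
        rw [hκ]; ring
      have hRr : R ≤ r := by linarith [hr.1]
      have hlR : 0 ≤ Real.log (r / R) := Real.log_nonneg ((one_le_div hR0).2 hRr)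
      calc C * (Real.log (r / R')) ^ (κ - 1) * r⁻¹
          = r ^ y * (Real.log (r / R')) ^ z * (A' ^ p * r ^ (a * p) * (Real.log t) ^ (-(p * b')) *
              (Real.log (r / R')) ^ (c' * p)) := by rw [e4, e5, hC]; ring
        _ ≤ r ^ y * (Real.log (r / R)) ^ z * (A' ^ p * r ^ (a * p) * (Real.log r) ^ (-b' * p) *
              (Real.log (r / R')) ^ (c' * p)) := by gcongr
        _ ≤ f r := by
          simp only [hf]
          gcongr
  set u := t / (1 + δ) with hu
  have hR'u : R' ≤ u := by rw [hu, le_div_iff₀ hd1]; linarith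
  have hut : u ≤ t := div_le_self ht0.le (by linarith)
  have hu0 : 0 < u := by linarith
  have hL : t / ((1 + δ) * R') = u / R' := by rw [hu]; field_simp
  have hL0 : 0 ≤ Real.log (u / R') := Real.log_nonneg ((one_le_div hR'0).2 hR'u)
  have hFi : ∀ v w, R ≤ v → v ≤ w → w ≤ t → IntervalIntegrable F volume v w := by
    intro v w hv hvw hw
    apply ContinuousOn.intervalIntegrable_of_Icc hvw
    exact hFc.mono (Set.Icc_subset_Icc hv hw)
  have hRu : R ≤ u := by linarith
  have o1 : (∫ s in R..t, F s) = (∫ s in R..u, F s) + ∫ s in u..t, F s :=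
    (intervalIntegral.integral_add_adjacent_intervals (hFi _ _ le_rfl hRu hut)
      (hFi _ _ hRu hut le_rfl)).symm
  have o2 : 0 ≤ ∫ s in R..u, F s := intervalIntegral.integral_nonneg hRu (fun s hs => hFnn s hs.1)
  have o3 : (∫ s in u..t, C * (Real.log (u / R')) ^ κ / κ) ≤ ∫ s in u..t, F s := by
    apply intervalIntegral.integral_mono_on hut intervalIntegrable_const (hFi _ _ hRu hut le_rfl)
    intro s hs
    refine le_trans ?_ (key s (hR'u.trans hs.1) hs.2)
    have : u ≤ s := hs.1
    gcongr
  rw [intervalIntegral.integral_const, smul_eq_mul] at o3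
  have o4 := hH2 t ⟨hRt, htT⟩
  refine le_trans ?_ o4
  have hta : t ^ a ≤ t := by
    calc t ^ a ≤ t ^ (1:ℝ) := Real.rpow_le_rpow_of_exponent_le ht1'.le ha
      _ = t := Real.rpow_one t
  have e6 : (Real.log t) ^ (-(p * b' - x)) = (Real.log t) ^ x * (Real.log t) ^ (-(p * b')) := by
    rw [← Real.rpow_add hlt]; congr 1; ring
  rw [hL, e6]
  calc δ * A' ^ p * B / ((1 + δ) * κ) * t ^ a * ((Real.log t) ^ x * (Real.log t) ^ (-(p * b'))) *
        (Real.log (u / R')) ^ κ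
      ≤ δ * A' ^ p * B / ((1 + δ) * κ) * t * ((Real.log t) ^ x * (Real.log t) ^ (-(p * b'))) *
        (Real.log (u / R')) ^ κ := by gcongr
    _ = B * (Real.log t) ^ x * ((t - u) * (C * (Real.log (u / R')) ^ κ / κ)) := by
        have : t - u = δ * t / (1 + δ) := by rw [hu]; field_simp; ring
        rw [this, hC]
        field_simp
    _ ≤ B * (Real.log t) ^ x * ∫ s in R..t, F s := by
        have : (t - u) * (C * (Real.log (u / R')) ^ κ / κ) ≤ ∫ s in R..t, F s := by linarith
        gcongr
end

section
/- Let A > 0, B > 0 and exponents c,z,p satisfy p > 1, z + c·p > −1 and z + c·p ≥ c − 1. Define c_0 = c, c_{j+1} = p·c_j + z + 1, and A_0 = A, A_{j+1} = 2^{−j}·A_j^p·B / ((1+2^{−j})·(p·c_j + z + 1)) for j ≥ 0. Then for every j ≥ 0: log A_{j+1} ≥ p·log A_j − (j+1)·log(2p) − log C₀, where C₀ := (1/B)·max{c + (z+1)/(p−1), c + (z+1)/p}. -/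
open Real

theorem Aj_iteration_estimate
    (A B c z p : ℝ)
    (hA : 0 < A) (hB : 0 < B)
    (hp : 1 < p) (hz1 : -1 < z + c * p) (hz2 : c - 1 ≤ z + c * p)
    (cs As : ℕ → ℝ)
    (hc0 : cs 0 = c) (hcrec : ∀ j, cs (j + 1) = p * cs j + z + 1)
    (hA0 : As 0 = A)
    (hArec : ∀ j : ℕ, As (j + 1) =
      (2 : ℝ) ^ (-(j : ℝ)) * As j ^ p * B / ((1 + (2 : ℝ) ^ (-(j : ℝ))) * (p * cs j + z + 1))) :
    ∀ j : ℕ, Real.log (As (j + 1)) ≥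
      p * Real.log (As j) - ((j : ℝ) + 1) * Real.log (2 * p) -
        Real.log ((1 / B) * max (c + (z + 1) / (p - 1)) (c + (z + 1) / p)) := by
  set M := max (c + (z + 1) / (p - 1)) (c + (z + 1) / p) with hM
  have hp0 : 0 < p := by linarith
  have hp1 : 0 < p - 1 := by linarith
  have hmono : ∀ j, cs j ≤ cs (j + 1) := by
    intro j
    induction j with
    | zero => rw [hcrec, hc0]; linarith
    | succ k ih =>
      rw [hcrec (k + 1)]
      nth_rewrite 1 [hcrec k]
      have := mul_le_mul_of_nonneg_left ih hp0.le
      linarith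
  have hcpos : ∀ j, 0 < cs (j + 1) := by
    intro j
    induction j with
    | zero => rw [hcrec, hc0]; linarith
    | succ k ih => exact lt_of_lt_of_le ih (hmono _)
  have hcle : ∀ j, cs (j + 1) ≤ p ^ (j + 1) * M := by
    rcases le_or_gt 0 (z + 1) with h | h
    · have key : ∀ j, cs j + (z + 1) / (p - 1) = p ^ j * (c + (z + 1) / (p - 1)) := by
        intro j
        induction j with
        | zero => simp [hc0]
        | succ k ih =>
          rw [hcrec, pow_succ, mul_right_comm, ← ih]
          field_simp
          ring
      intro j
      have h1 := key (j + 1)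
      have h2 : 0 ≤ (z + 1) / (p - 1) := by positivity
      have h3 : p ^ (j + 1) * (c + (z + 1) / (p - 1)) ≤ p ^ (j + 1) * M :=
        mul_le_mul_of_nonneg_left (le_max_left _ _) (by positivity)
      linarith
    · intro j
      induction j with
      | zero =>
        have h3 : p * (c + (z + 1) / p) ≤ p * M :=
          mul_le_mul_of_nonneg_left (le_max_right _ _) hp0.le
        have h4 : p * (c + (z + 1) / p) = p * c + z + 1 := by field_simp; ring
        rw [hcrec, hc0, zero_add, pow_one]; linarith
      | succ k ih =>
        rw [hcrec (k + 1), pow_succ]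
        have := mul_le_mul_of_nonneg_left ih hp0.le
        nlinarith
  have hMpos : 0 < M := by
    have h := lt_of_lt_of_le (hcpos 0) (hcle 0)
    exact pos_of_mul_pos_right h (by positivity)
  have hApos : ∀ j, 0 < As j := by
    intro j
    induction j with
    | zero => rw [hA0]; exact hA
    | succ k ih =>
      have := hcpos k
      rw [hArec, ← hcrec]
      have := Real.rpow_pos_of_pos ih p
      positivity
  intro j
  have hAj := hApos j
  have hcj := hcpos j
  have hAp := Real.rpow_pos_of_pos hAj p
  have hle : As j ^ p / ((2 * p) ^ (j + 1) * (1 / B * M)) ≤ As (j + 1) := by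
    rw [hArec, ← hcrec, Real.rpow_neg (by norm_num), Real.rpow_natCast]
    have e : ((2 : ℝ) ^ j)⁻¹ * As j ^ p * B / ((1 + ((2 : ℝ) ^ j)⁻¹) * cs (j + 1))
        = As j ^ p / ((2 ^ j + 1) * cs (j + 1) / B) := by
      field_simp
    rw [e]
    apply div_le_div_of_nonneg_left hAp.le (by positivity)
    have h1 : (2 : ℝ) ^ j + 1 ≤ 2 ^ (j + 1) := by
      have : (1 : ℝ) ≤ 2 ^ j := one_le_pow₀ (by norm_num)
      rw [pow_succ]; linarith
    have h2 := mul_le_mul h1 (hcle j) hcj.le (by positivity)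
    have h3 : (2 * p) ^ (j + 1) * (1 / B * M) = 2 ^ (j + 1) * (p ^ (j + 1) * M) / B := by
      rw [mul_pow]; field_simp
    rw [h3]
    exact div_le_div_of_nonneg_right h2 hB.le
  have hl := Real.log_le_log (by positivity) hle
  rw [Real.log_div hAp.ne' (by positivity), Real.log_mul (by positivity) (by positivity),
    Real.log_pow, Real.log_rpow hAj] at hl
  push_cast at hl
  linarith
end

section
/- Let A > 0, B > 0 and T > R > 1 be real constants and let the exponents a,b,c,x,y,z,p satisfy condition (E) together with z ≥ 0. If a continuous function H : [R,T) → ℝ satisfies the system (NII), then for every j ≥ 0 and every t ∈ [R_∞², T): H(t) ≥ 2^{(z+1)/(p−1)} · (2p)^{(p+(p−1)j)/(p−1)²} · C₀^{1/(p−1)} · t^a · (log t)^{−(x+z+1)/(p−1)} · ( A·(log t)^{c−b+(x+z+1)/(p−1)} / ( 2^{c+(z+1)/(p−1)}·(2p)^{p/(p−1)²}·C₀^{1/(p−1)} ) )^{p^j}. -/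
open Real MeasureTheory

/-- Continuity at `R` forces `c ≥ 0`. -/
theorem aux_c_nonneg (A T R a b c : ℝ) (hA : 0 < A) (hR : 1 < R) (hT : R < T)
    (H : ℝ → ℝ) (hHc : ContinuousOn H (Set.Ico R T))
    (hH1 : ∀ t ∈ Set.Ico R T,
      A * t ^ a * (Real.log t) ^ (-b) * (Real.log (t / R)) ^ c ≤ H t) : 0 ≤ c := by
  by_contra hc
  push Not at hc
  have hR0 : 0 < R := by linarith
  have hlogR : 0 < Real.log R := Real.log_pos hR
  have hsub : nhdsWithin R (Set.Ioi R) ≤ nhdsWithin R (Set.Ico R T) := by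
    rw [← nhdsWithin_Ioo_eq_nhdsGT hT]
    exact nhdsWithin_mono _ Set.Ioo_subset_Ico_self
  have h1 : Filter.Tendsto H (nhdsWithin R (Set.Ioi R)) (nhds (H R)) :=
    (hHc R ⟨le_rfl, hT⟩).mono_left hsub
  have h2 : Filter.Tendsto (fun t : ℝ => A * t ^ a * (Real.log t) ^ (-b))
      (nhdsWithin R (Set.Ioi R)) (nhds (A * R ^ a * (Real.log R) ^ (-b))) := by
    have : ContinuousAt (fun t : ℝ => A * t ^ a * (Real.log t) ^ (-b)) R := by
      refine ContinuousAt.mul (ContinuousAt.mul continuousAt_const ?_) ?_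
      · exact Real.continuousAt_rpow_const _ _ (Or.inl hR0.ne')
      · exact (Real.continuousAt_log hR0.ne').rpow_const (Or.inl hlogR.ne')
    exact this.mono_left nhdsWithin_le_nhds
  have h3 : Filter.Tendsto (fun t : ℝ => Real.log (t / R))
      (nhdsWithin R (Set.Ioi R)) (nhdsWithin 0 (Set.Ioi 0)) := by
    refine tendsto_nhdsWithin_iff.2 ⟨?_, ?_⟩
    · have : ContinuousAt (fun t : ℝ => Real.log (t / R)) R := by
        refine ContinuousAt.log (by fun_prop) ?_
        rw [div_self hR0.ne']; exact one_ne_zero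
      have h := this.tendsto
      simp only [div_self hR0.ne', Real.log_one] at h
      exact h.mono_left nhdsWithin_le_nhds
    · filter_upwards [self_mem_nhdsWithin] with t ht
      exact Real.log_pos ((one_lt_div hR0).2 ht)
  have h4 := (tendsto_rpow_neg_nhdsGT_zero hc).comp h3
  have h5 := Filter.Tendsto.pos_mul_atTop (by positivity) h2 h4
  have h6 : Filter.Tendsto H (nhdsWithin R (Set.Ioi R)) Filter.atTop := by
    refine Filter.tendsto_atTop_mono' _ ?_ h5
    have : Set.Ioo R T ∈ nhdsWithin R (Set.Ioi R) := Ioo_mem_nhdsGT hT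
    filter_upwards [this] with t ht
    exact hH1 t ⟨ht.1.le, ht.2⟩
  exact not_tendsto_nhds_of_tendsto_atTop h6 _ h1

/-- One slicing step. -/
theorem aux_step (B T R a x y z p : ℝ) (hB : 0 < B) (hR : 1 < R)
    (hp : 1 < p) (ha : a ≤ 1) (hy : y + p * a = -1) (hz0 : 0 ≤ z)
    (H : ℝ → ℝ) (hHc : ContinuousOn H (Set.Ico R T))
    (hH2 : ∀ t ∈ Set.Ico R T,
      B * (Real.log t) ^ x *
        ∫ s in R..t, ∫ r in R..s, r ^ y * (Real.log (r / R)) ^ z * |H r| ^ p ≤ H t)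
    (Q ε D β γ : ℝ) (hQ : R ≤ Q) (hε : 0 < ε) (hD : 0 < D) (hβ : 0 ≤ β) (hγ : 0 ≤ γ)
    (hyp : ∀ t ∈ Set.Ico Q T, D * t ^ a * (Real.log t) ^ (-β) * (Real.log (t / Q)) ^ γ ≤ H t) :
    ∀ t ∈ Set.Ico (Q * (1 + ε)) T,
      (B * D ^ p / (z + γ * p + 1) * (ε / (1 + ε))) * t ^ a * (Real.log t) ^ (-(p * β - x)) *
        (Real.log (t / (Q * (1 + ε)))) ^ (p * γ + z + 1) ≤ H t := by
  intro t ht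
  have hR0 : 0 < R := by linarith
  have hQ0 : 0 < Q := by linarith
  have hp0 : 0 < p := by linarith
  have hQQ : Q ≤ Q * (1 + ε) := by nlinarith
  have hQt : Q ≤ t := hQQ.trans ht.1
  have hRt : R ≤ t := hQ.trans hQt
  have ht0 : 0 < t := by linarith
  have hlt : 0 < Real.log t := Real.log_pos (by linarith)
  have hq1 : 0 < z + γ * p + 1 := by positivity
  set F : ℝ → ℝ := fun r => r ^ y * (Real.log (r / R)) ^ z * |H r| ^ p with hF
  have hFc : ContinuousOn F (Set.Icc R t) := by
    have hsub : Set.Icc R t ⊆ Set.Ico R T := fun r hr => ⟨hr.1, hr.2.trans_lt ht.2⟩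
    refine ContinuousOn.mul (ContinuousOn.mul ?_ ?_) ?_
    · exact continuousOn_id.rpow_const fun r hr => Or.inl (by
        have := hr.1; simp only [id]; linarith)
    · refine ContinuousOn.rpow_const (ContinuousOn.log (by fun_prop) ?_) fun r hr => Or.inr hz0
      intro r hr
      have := hr.1
      have : 0 < r := by linarith
      positivity
    · exact (hHc.mono hsub).abs.rpow_const fun r hr => Or.inr hp0.le
  have hFn : ∀ r ∈ Set.Icc R t, 0 ≤ F r := by
    intro r hr
    have h1 : 0 < r := by have := hr.1; linarith
    have h2 : 0 ≤ Real.log (r / R) := Real.log_nonneg ((one_le_div hR0).2 hr.1)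
    simp only [hF]; positivity
  have hFint : ∀ u v, R ≤ u → u ≤ v → v ≤ t → IntervalIntegrable F volume u v := by
    intro u v h1 h2 h3
    apply ContinuousOn.intervalIntegrable
    rw [Set.uIcc_of_le h2]
    exact hFc.mono (Set.Icc_subset_Icc h1 h3)
  set M : ℝ := D ^ p * (Real.log t) ^ (-β * p) with hM
  have hM0 : 0 < M := by positivity
  -- inner lower bound
  have hinner : ∀ s ∈ Set.Icc Q t,
      M * (Real.log (s / Q)) ^ (z + γ * p + 1) / (z + γ * p + 1) ≤ ∫ r in R..s, F r := by
    intro s hs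
    have hsplit : ∫ r in Q..s, F r ≤ ∫ r in R..s, F r := by
      apply intervalIntegral.integral_mono_interval hQ hs.1 le_rfl
      · filter_upwards [ae_restrict_mem measurableSet_Ioc] with r hr
        exact hFn r ⟨hr.1.le, hr.2.trans hs.2⟩
      · exact hFint R s le_rfl (hQ.trans hs.1) hs.2
    refine le_trans ?_ hsplit
    have key := intervalIntegral.sub_le_integral_of_hasDeriv_right_of_le
      (g := fun r => M * (Real.log (r / Q)) ^ (z + γ * p + 1) / (z + γ * p + 1))
      (g' := fun r => M * (Real.log (r / Q)) ^ (z + γ * p) * r⁻¹) (φ := F) hs.1 ?_ ?_ ?_ ?_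
    · simpa [div_self hQ0.ne', Real.zero_rpow hq1.ne'] using key
    · refine ContinuousOn.div_const (ContinuousOn.mul continuousOn_const ?_) _
      refine ContinuousOn.rpow_const (ContinuousOn.log (by fun_prop) ?_) fun r hr => Or.inr hq1.le
      intro r hr
      have := hr.1
      have : 0 < r := by linarith
      positivity
    · intro r hr
      have hr0 : 0 < r := hQ0.trans hr.1
      have hl : 0 < Real.log (r / Q) := Real.log_pos ((one_lt_div hQ0).2 hr.1)
      have h1 : HasDerivAt (fun r => Real.log (r / Q)) (r⁻¹) r := by
        have := ((hasDerivAt_id r).div_const Q).log (by simp; exact ⟨hr0.ne', hQ0.ne'⟩)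
        refine this.congr_deriv ?_
        change 1 / Q / (r / Q) = r⁻¹
        field_simp
      have h2 := ((h1.rpow_const (p := z + γ * p + 1) (Or.inl hl.ne')).const_mul M).div_const
        (z + γ * p + 1)
      refine (h2.congr_deriv ?_).hasDerivWithinAt
      rw [add_sub_cancel_right]
      field_simp
    · exact (hFc.mono (Set.Icc_subset_Icc hQ hs.2)).integrableOn_Icc
    · intro r hr
      have hr0 : 0 < r := hQ0.trans hr.1
      have hr1 : 1 < r := by have := hr.1; linarith
      have hrt : r ≤ t := hr.2.le.trans hs.2
      have hl : 0 < Real.log (r / Q) := Real.log_pos ((one_lt_div hQ0).2 hr.1)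
      have hlr : 0 < Real.log r := Real.log_pos hr1
      have hlR : Real.log (r / Q) ≤ Real.log (r / R) :=
        Real.log_le_log (by positivity) (by gcongr)
      have hH := hyp r ⟨hr.1.le, hrt.trans_lt ht.2⟩
      have hpos : 0 < D * r ^ a * (Real.log r) ^ (-β) * (Real.log (r / Q)) ^ γ := by positivity
      have hHp : (D * r ^ a * (Real.log r) ^ (-β) * (Real.log (r / Q)) ^ γ) ^ p ≤ |H r| ^ p :=
        Real.rpow_le_rpow hpos.le (hH.trans (le_abs_self _)) hp0.le
      have hexp : (D * r ^ a * (Real.log r) ^ (-β) * (Real.log (r / Q)) ^ γ) ^ p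
          = D ^ p * r ^ (a * p) * (Real.log r) ^ (-β * p) * (Real.log (r / Q)) ^ (γ * p) := by
        rw [Real.mul_rpow (by positivity) (by positivity), Real.mul_rpow (by positivity)
          (by positivity), Real.mul_rpow (by positivity) (by positivity),
          ← Real.rpow_mul hr0.le, ← Real.rpow_mul hlr.le, ← Real.rpow_mul hl.le]
      rw [hexp] at hHp
      have hmono : (Real.log t) ^ (-β * p) ≤ (Real.log r) ^ (-β * p) :=
        Real.rpow_le_rpow_of_nonpos hlr (Real.log_le_log hr0 hrt) (by nlinarith)
      have hz : (Real.log (r / Q)) ^ z ≤ (Real.log (r / R)) ^ z :=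
        Real.rpow_le_rpow hl.le hlR hz0
      have hry : r ^ y * r ^ (a * p) = r⁻¹ := by
        rw [← Real.rpow_add hr0, ← Real.rpow_neg_one]
        congr 1; linarith
      calc M * (Real.log (r / Q)) ^ (z + γ * p) * r⁻¹
          = r ^ y * (Real.log (r / Q)) ^ z *
            (D ^ p * r ^ (a * p) * (Real.log t) ^ (-β * p) * (Real.log (r / Q)) ^ (γ * p)) := by
            rw [← hry, hM, Real.rpow_add hl]; ring
        _ ≤ r ^ y * (Real.log (r / R)) ^ z *
            (D ^ p * r ^ (a * p) * (Real.log r) ^ (-β * p) * (Real.log (r / Q)) ^ (γ * p)) := by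
            have : 0 ≤ Real.log (r / R) := hl.le.trans hlR
            have : 0 ≤ r ^ y * (Real.log (r / R)) ^ z := by positivity
            gcongr
        _ ≤ F r := by
            simp only [hF]
            have : 0 ≤ Real.log (r / R) := hl.le.trans hlR
            gcongr
  -- outer
  set G : ℝ → ℝ := fun s => ∫ r in R..s, F r with hG
  have hGc : ContinuousOn G (Set.Icc R t) := by
    have := intervalIntegral.continuousOn_primitive_interval (a := R) (b := t) (f := F)
      (μ := volume) (by rw [Set.uIcc_of_le hRt]; exact hFc.integrableOn_Icc)
    rwa [Set.uIcc_of_le hRt] at this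
  have hGn : ∀ s ∈ Set.Icc R t, 0 ≤ G s := by
    intro s hs
    exact intervalIntegral.integral_nonneg hs.1 fun r hr => hFn r ⟨hr.1, hr.2.trans hs.2⟩
  have h1ε : 0 < 1 + ε := by linarith
  set u : ℝ := t / (1 + ε) with hu
  have hu1 : Q ≤ u := by rw [hu, le_div_iff₀ h1ε]; exact ht.1
  have hu2 : u ≤ t := by rw [hu, div_le_iff₀ h1ε]; nlinarith
  set W : ℝ := Real.log (t / (Q * (1 + ε))) with hW
  have hW0 : 0 ≤ W := Real.log_nonneg ((one_le_div (by positivity)).2 ht.1)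
  have houter : (t - u) * (M * W ^ (z + γ * p + 1) / (z + γ * p + 1)) ≤ ∫ s in R..t, G s := by
    have hRu : R ≤ u := hQ.trans hu1
    have i1 : IntervalIntegrable G volume R t := by
      apply ContinuousOn.intervalIntegrable; rwa [Set.uIcc_of_le hRt]
    have i2 : IntervalIntegrable G volume u t := by
      apply ContinuousOn.intervalIntegrable; rw [Set.uIcc_of_le hu2]
      exact hGc.mono (Set.Icc_subset_Icc hRu le_rfl)
    have h1 : ∫ s in u..t, G s ≤ ∫ s in R..t, G s := by
      apply intervalIntegral.integral_mono_interval hRu hu2 le_rfl _ i1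
      filter_upwards [ae_restrict_mem measurableSet_Ioc] with r hr
      exact hGn r ⟨hr.1.le, hr.2⟩
    refine le_trans ?_ h1
    have h2 := intervalIntegral.integral_mono_on
      (f := fun _ => M * W ^ (z + γ * p + 1) / (z + γ * p + 1)) (g := G) hu2
      (intervalIntegrable_const (μ := volume)) i2 ?_
    · rwa [intervalIntegral.integral_const, smul_eq_mul] at h2
    · intro s hs
      refine le_trans ?_ (hinner s ⟨hu1.trans hs.1, hs.2⟩)
      have : W ≤ Real.log (s / Q) := by
        apply Real.log_le_log (by positivity)
        have : t / (Q * (1 + ε)) = u / Q := by rw [hu]; field_simp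
        rw [this]
        have := hs.1
        gcongr
      gcongr
  have htu : t - u = t * (ε / (1 + ε)) := by rw [hu]; field_simp; ring
  have hta : t ^ a ≤ t := by
    calc t ^ a ≤ t ^ (1 : ℝ) := Real.rpow_le_rpow_of_exponent_le (by linarith) ha
      _ = t := Real.rpow_one t
  refine le_trans ?_ (hH2 t ⟨hRt, ht.2⟩)
  calc (B * D ^ p / (z + γ * p + 1) * (ε / (1 + ε))) * t ^ a * (Real.log t) ^ (-(p * β - x)) *
        W ^ (p * γ + z + 1)
      ≤ (B * D ^ p / (z + γ * p + 1) * (ε / (1 + ε))) * t * (Real.log t) ^ (-(p * β - x)) *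
        W ^ (p * γ + z + 1) := by gcongr
    _ = B * (Real.log t) ^ x * ((t - u) * (M * W ^ (z + γ * p + 1) / (z + γ * p + 1))) := by
        have e1 : -(p * β - x) = x + (-β * p) := by ring
        have e2 : p * γ + z + 1 = z + γ * p + 1 := by ring
        rw [e1, e2, Real.rpow_add hlt, htu, hM]
        ring
    _ ≤ _ := by gcongr

theorem aux_Rj_le (R : ℝ) (hR : 0 < R) (j : ℕ) :
    R * ∏ k ∈ Finset.range j, (1 + (2 : ℝ) ^ (-(k : ℝ))) ≤ Rinf R := by
  unfold Rinf
  refine mul_le_mul_of_nonneg_left ?_ hR.le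
  have hs : Summable (fun k : ℕ => (2 : ℝ) ^ (-(k : ℝ))) := by
    refine summable_geometric_two.congr fun k => ?_
    rw [Real.rpow_neg (by norm_num), Real.rpow_natCast]; simp
  have hm := (Real.multipliable_one_add_of_summable hs).hasProd.tendsto_prod_nat
  refine Monotone.ge_of_tendsto ?_ hm j
  refine monotone_nat_of_le_succ fun n => ?_
  rw [Finset.prod_range_succ]
  have h1 : 0 ≤ ∏ k ∈ Finset.range n, (1 + (2 : ℝ) ^ (-(k : ℝ))) :=
    Finset.prod_nonneg fun k _ => by positivity
  have h2 : 0 ≤ (2 : ℝ) ^ (-(n : ℝ)) := by positivity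
  nlinarith

/-- The coefficient sequence. -/
theorem aux_exp_identity (lA l2 m κ τ ℓ a b c x z p P j : ℝ) (hp : 1 < p) :
    exp l2 ^ ((z + 1) / (p - 1)) * exp m ^ ((p + (p - 1) * j) / (p - 1) ^ 2) *
        exp κ ^ (1 / (p - 1)) * exp τ ^ a * exp ℓ ^ (-(x + z + 1) / (p - 1)) *
        (exp lA * exp ℓ ^ (c - b + (x + z + 1) / (p - 1)) /
          (exp l2 ^ (c + (z + 1) / (p - 1)) * exp m ^ (p / (p - 1) ^ 2) *
            exp κ ^ (1 / (p - 1)))) ^ P =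
    exp (P * (lA - (κ / (p - 1) + p * m / (p - 1) ^ 2)) + (κ / (p - 1) + p * m / (p - 1) ^ 2)
        + m / (p - 1) * j) * exp τ ^ a *
      exp ℓ ^ (-(P * (b - x / (p - 1)) + x / (p - 1))) *
      (exp ℓ / exp l2) ^ (P * (c + (z + 1) / (p - 1)) - (z + 1) / (p - 1)) := by
  have hp1 : p - 1 ≠ 0 := by linarith
  simp only [← Real.exp_mul, ← Real.exp_add, ← Real.exp_sub]
  congr 1
  field_simp
  ring

theorem aux_main (A B T R a b c x y z p : ℝ)
    (hA : 0 < A) (hB : 0 < B) (hR : 1 < R)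
    (hp : 1 < p) (ha : a ≤ 1) (hb : max 0 (x / (p - 1)) ≤ b)
    (hy : y + p * a = -1) (hc : 0 ≤ c) (hz0 : 0 ≤ z)
    (H : ℝ → ℝ) (hHc : ContinuousOn H (Set.Ico R T))
    (hH1 : ∀ t ∈ Set.Ico R T,
      A * t ^ a * (Real.log t) ^ (-b) * (Real.log (t / R)) ^ c ≤ H t)
    (hH2 : ∀ t ∈ Set.Ico R T,
      B * (Real.log t) ^ x *
        ∫ s in R..t, ∫ r in R..s, r ^ y * (Real.log (r / R)) ^ z * |H r| ^ p ≤ H t)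
    (m κ : ℝ) (hm : exp m = 2 * p) (hκ : exp κ = (1 / B) * (c + (z + 1) / (p - 1))) (j : ℕ) :
    ∀ t ∈ Set.Ico (R * ∏ k ∈ Finset.range j, (1 + (2 : ℝ) ^ (-(k : ℝ)))) T,
      exp (p ^ j * (Real.log A - (κ / (p - 1) + p * m / (p - 1) ^ 2))
          + (κ / (p - 1) + p * m / (p - 1) ^ 2) + m / (p - 1) * j) * t ^ a *
      (Real.log t) ^ (-(p ^ j * (b - x / (p - 1)) + x / (p - 1))) *
      (Real.log (t / (R * ∏ k ∈ Finset.range j, (1 + (2 : ℝ) ^ (-(k : ℝ)))))) ^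
        (p ^ j * (c + (z + 1) / (p - 1)) - (z + 1) / (p - 1)) ≤ H t := by
  have hp1 : 0 < p - 1 := by linarith
  induction j with
  | zero =>
    intro t ht
    have h := hH1 t (by simpa using ht)
    simpa [Real.exp_log hA] using h
  | succ j ih =>
    have hPj : 1 ≤ p ^ j := one_le_pow₀ hp.le
    set Q : ℝ := R * ∏ k ∈ Finset.range j, (1 + (2 : ℝ) ^ (-(k : ℝ))) with hQ
    have hQR : R ≤ Q := by
      have : (1 : ℝ) ≤ ∏ k ∈ Finset.range j, (1 + (2 : ℝ) ^ (-(k : ℝ))) := by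
        refine Finset.prod_induction _ (fun v : ℝ => 1 ≤ v)
          (fun u v hu hv => one_le_mul_of_one_le_of_one_le hu hv) le_rfl ?_
        intro k hk
        have : 0 ≤ (2 : ℝ) ^ (-(k : ℝ)) := by positivity
        linarith
      nlinarith
    have hβ : 0 ≤ p ^ j * (b - x / (p - 1)) + x / (p - 1) := by
      have h1 : 0 ≤ b := (le_max_left _ _).trans hb
      have h2 : 0 ≤ b - x / (p - 1) := sub_nonneg.2 ((le_max_right _ _).trans hb)
      nlinarith
    have hw : 0 < (z + 1) / (p - 1) := by positivity
    have hγ : 0 ≤ p ^ j * (c + (z + 1) / (p - 1)) - (z + 1) / (p - 1) := by nlinarith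
    have hst := aux_step B T R a x y z p hB hR hp ha hy hz0 H hHc hH2 Q ((2 : ℝ) ^ (-(j : ℝ)))
      _ _ _ hQR (by positivity) (Real.exp_pos _) hβ hγ ih
    intro t ht
    have hQ' : R * ∏ k ∈ Finset.range (j + 1), (1 + (2 : ℝ) ^ (-(k : ℝ)))
        = Q * (1 + (2 : ℝ) ^ (-(j : ℝ))) := by
      rw [Finset.prod_range_succ, hQ]; ring
    rw [hQ'] at ht ⊢
    refine le_trans ?_ (hst t ht)
    have e1 : p * (p ^ j * (b - x / (p - 1)) + x / (p - 1)) - x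
        = p ^ (j + 1) * (b - x / (p - 1)) + x / (p - 1) := by
      field_simp; ring
    have e2 : p * (p ^ j * (c + (z + 1) / (p - 1)) - (z + 1) / (p - 1)) + z + 1
        = p ^ (j + 1) * (c + (z + 1) / (p - 1)) - (z + 1) / (p - 1) := by
      field_simp; ring
    have e3 : z + (p ^ j * (c + (z + 1) / (p - 1)) - (z + 1) / (p - 1)) * p + 1
        = p ^ (j + 1) * (c + (z + 1) / (p - 1)) - (z + 1) / (p - 1) := by
      rw [← e2]; ring
    rw [e1, e2, e3]
    have hPj1 : 1 < p ^ (j + 1) := one_lt_pow₀ hp (by omega)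
    have hK : 0 < c + (z + 1) / (p - 1) := by positivity
    have hc1 : 0 < p ^ (j + 1) * (c + (z + 1) / (p - 1)) - (z + 1) / (p - 1) := by nlinarith
    have hQpos : 0 < Q * (1 + (2 : ℝ) ^ (-(j : ℝ))) := by
      have : 0 < Q := by linarith
      positivity
    have hlQ : 0 ≤ Real.log (t / (Q * (1 + (2 : ℝ) ^ (-(j : ℝ))))) :=
      Real.log_nonneg ((one_le_div hQpos).2 ht.1)
    have ht1 : 1 < t := by
      have h0 : 0 ≤ (2 : ℝ) ^ (-(j : ℝ)) := by positivity
      have := ht.1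
      nlinarith
    have hlt : 0 < Real.log t := Real.log_pos ht1
    have ht0 : 0 < t := by linarith
    gcongr ?_ * _ * _ * _
    -- the coefficient inequality
    set E : ℝ := p ^ j * (Real.log A - (κ / (p - 1) + p * m / (p - 1) ^ 2))
          + (κ / (p - 1) + p * m / (p - 1) ^ 2) + m / (p - 1) * j with hE
    have hrec : exp (p ^ (j + 1) * (Real.log A - (κ / (p - 1) + p * m / (p - 1) ^ 2))
          + (κ / (p - 1) + p * m / (p - 1) ^ 2) + m / (p - 1) * ((j + 1 : ℕ) : ℝ))
        * (exp κ * exp m ^ (j + 1)) = exp E ^ p := by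
      rw [← Real.exp_mul, ← Real.exp_nat_mul, ← Real.exp_add, ← Real.exp_add, hE]
      congr 1
      push_cast
      field_simp
      ring
    have hpos : 0 < exp κ * exp m ^ (j + 1) := by positivity
    rw [← eq_div_iff hpos.ne'] at hrec
    rw [hrec, hκ, hm]
    have hεe : (2 : ℝ) ^ (-(j : ℝ)) / (1 + (2 : ℝ) ^ (-(j : ℝ))) = 1 / (2 ^ j + 1) := by
      rw [Real.rpow_neg (by norm_num), Real.rpow_natCast]
      field_simp
    rw [hεe]
    have h2j : (1 : ℝ) ≤ 2 ^ j := one_le_pow₀ (by norm_num)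
    have hden : (p ^ (j + 1) * (c + (z + 1) / (p - 1)) - (z + 1) / (p - 1)) * (2 ^ j + 1)
        ≤ (c + (z + 1) / (p - 1)) * (2 * p) ^ (j + 1) := by
      calc _ ≤ (p ^ (j + 1) * (c + (z + 1) / (p - 1))) * (2 ^ j + 2 ^ j) := by
            gcongr; linarith
        _ = _ := by rw [mul_pow]; ring
    calc exp E ^ p / (1 / B * (c + (z + 1) / (p - 1)) * (2 * p) ^ (j + 1))
        = B * exp E ^ p / ((c + (z + 1) / (p - 1)) * (2 * p) ^ (j + 1)) := by
          rw [mul_assoc, one_div, inv_mul_eq_div, div_div_eq_mul_div, mul_comm B]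
      _ ≤ B * exp E ^ p /
          ((p ^ (j + 1) * (c + (z + 1) / (p - 1)) - (z + 1) / (p - 1)) * (2 ^ j + 1)) := by
          gcongr
      _ = _ := by rw [div_mul_div_comm, mul_one]

theorem lower_bound_beyond_Rinf_sq
    (A B T R a b c x y z p : ℝ)
    (hA : 0 < A) (hB : 0 < B) (hR : 1 < R) (hT : R < T)
    -- condition (E)
    (hp : 1 < p) (ha : a ≤ 1) (hb : max 0 (x / (p - 1)) ≤ b)
    (hy : y + p * a = -1) (hz1 : -1 < z + c * p) (hz2 : c - 1 ≤ z + c * p)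
    -- extra assumption
    (hz0 : 0 ≤ z)
    -- the system (NII)
    (H : ℝ → ℝ) (hHc : ContinuousOn H (Set.Ico R T))
    (hH1 : ∀ t ∈ Set.Ico R T,
      A * t ^ a * (Real.log t) ^ (-b) * (Real.log (t / R)) ^ c ≤ H t)
    (hH2 : ∀ t ∈ Set.Ico R T,
      B * (Real.log t) ^ x *
        ∫ s in R..t, ∫ r in R..s, r ^ y * (Real.log (r / R)) ^ z * |H r| ^ p ≤ H t) :
    ∀ j : ℕ, ∀ t ∈ Set.Ico ((Rinf R) ^ 2) T,
      (2 : ℝ) ^ ((z + 1) / (p - 1)) *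
        (2 * p) ^ ((p + (p - 1) * (j : ℝ)) / (p - 1) ^ 2) *
        ((1 / B) * max (c + (z + 1) / (p - 1)) (c + (z + 1) / p)) ^ (1 / (p - 1)) *
        t ^ a * (Real.log t) ^ (-(x + z + 1) / (p - 1)) *
        (A * (Real.log t) ^ (c - b + (x + z + 1) / (p - 1)) /
          ((2 : ℝ) ^ (c + (z + 1) / (p - 1)) * (2 * p) ^ (p / (p - 1) ^ 2) *
            ((1 / B) * max (c + (z + 1) / (p - 1)) (c + (z + 1) / p)) ^ (1 / (p - 1)))) ^
          (p ^ j) ≤ H t := by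
  intro j t ht
  have hp1 : 0 < p - 1 := by linarith
  have hR0 : 0 < R := by linarith
  have hc : 0 ≤ c := aux_c_nonneg A T R a b c hA hR hT H hHc hH1
  have hmax : max (c + (z + 1) / (p - 1)) (c + (z + 1) / p) = c + (z + 1) / (p - 1) := by
    apply max_eq_left
    gcongr
    linarith
  rw [hmax]
  have hw : 0 < (z + 1) / (p - 1) := by positivity
  have hPj : 1 ≤ p ^ j := one_le_pow₀ hp.le
  have hγ : 0 ≤ p ^ j * (c + (z + 1) / (p - 1)) - (z + 1) / (p - 1) := by nlinarith
  have hC : 0 < (1 / B) * (c + (z + 1) / (p - 1)) := by positivity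
  have h2p : 0 < 2 * p := by linarith
  have hle := aux_Rj_le R hR0 j
  have hRinf : R ≤ Rinf R := by simpa using aux_Rj_le R hR0 0
  have hRi0 : 0 < Rinf R := by linarith
  have hRi1 : 1 < Rinf R := by linarith
  have hsq : Rinf R ≤ Rinf R ^ 2 := by nlinarith
  have ht1 : 1 < t := by have := ht.1; linarith
  have ht0 : 0 < t := by linarith
  have hlt : 0 < Real.log t := Real.log_pos ht1
  have hmain := aux_main A B T R a b c x y z p hA hB hR hp ha hb hy hc hz0 H hHc hH1 hH2
    (Real.log (2 * p)) (Real.log ((1 / B) * (c + (z + 1) / (p - 1))))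
    (Real.exp_log h2p) (Real.exp_log hC) j t ⟨hle.trans (hsq.trans ht.1), ht.2⟩
  refine le_trans ?_ hmain
  have hid := aux_exp_identity (Real.log A) (Real.log 2) (Real.log (2 * p))
    (Real.log ((1 / B) * (c + (z + 1) / (p - 1)))) (Real.log t) (Real.log (Real.log t))
    a b c x z p (p ^ j) j hp
  rw [Real.exp_log hA, Real.exp_log two_pos, Real.exp_log h2p, Real.exp_log hC,
    Real.exp_log ht0, Real.exp_log hlt] at hid
  rw [hid]
  have hQ0 : 0 < R * ∏ k ∈ Finset.range j, (1 + (2 : ℝ) ^ (-(k : ℝ))) :=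
    mul_pos hR0 (Finset.prod_pos fun k _ => by positivity)
  have hhalf : Real.log t / 2 ≤
      Real.log (t / (R * ∏ k ∈ Finset.range j, (1 + (2 : ℝ) ^ (-(k : ℝ))))) := by
    rw [Real.log_div ht0.ne' hQ0.ne']
    have h1 : Real.log (R * ∏ k ∈ Finset.range j, (1 + (2 : ℝ) ^ (-(k : ℝ))))
        ≤ Real.log (Rinf R) := Real.log_le_log hQ0 hle
    have h2 : Real.log (Rinf R ^ 2) ≤ Real.log t := Real.log_le_log (by positivity) ht.1
    rw [Real.log_pow] at h2
    push_cast at h2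
    linarith
  gcongr
end
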